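/- arXiv:1801.06705 — 2 statements merged into one kernel-verified Lean document; each statement's English description precedes it below -/
import Mathlib

section
/- Let A be a C*-algebra. Then A admits a tracial functional (a non-zero continuous linear functional φ with φ(ab) = φ(ba) for all a,b) if and only if A admits a tracial state. Equivalently, the closed linear span of commutators of A is a proper subspace iff A has a tracial state. -/
open scoped ComplexOrder

/-- A real-linear functional on a C⋆-algebra that is non-negative on positive elements and
invariant under the involution, i.e. the real part of a positive functional. -/
structure IsHermitianPositive {B : Type*} [CStarAlgebra B] [PartialOrder B]
    (f : B →ₗ[ℝ] ℝ) : Prop where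
  nonneg : ∀ a, 0 ≤ a → 0 ≤ f a
  map_star : ∀ a, f (star a) = f a

theorem mul_comm_of_unitary_conjugate {B : Type*} [CStarAlgebra B] (F : B →L[ℂ] ℂ)
    (h : ∀ u ∈ unitary B, ∀ a, F (u * a * star u) = F a) (a b : B) : F (a * b) = F (b * a) := by
  have ha : a ∈ Submodule.span ℂ (unitary B : Set B) := by
    rw [CStarAlgebra.span_unitary]; trivial
  induction ha using Submodule.span_induction with
  | mem u hu =>
    have := h u hu (b * u)
    rwa [mul_assoc, mul_assoc, Unitary.mul_star_self_of_mem hu, mul_one] at this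
  | zero => simp
  | add x y _ _ hx hy => rw [add_mul, mul_add, map_add, map_add, hx, hy]
  | smul c x _ hx => rw [smul_mul_assoc, mul_smul_comm, map_smul, map_smul, hx]

theorem IsHermitianPositive.eq_of_selfAdjoint {B : Type*} [CStarAlgebra B] [PartialOrder B]
    {f f' : B →ₗ[ℝ] ℝ} (hf : IsHermitianPositive f) (hf' : IsHermitianPositive f')
    (h : ∀ a, IsSelfAdjoint a → ‖a‖ ≤ 1 → f a = f' a) : f = f' := by
  have hsa : ∀ a, IsSelfAdjoint a → f a = f' a := by
    intro a ha
    rcases eq_or_ne a 0 with rfl | h0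
    · simp
    have hn : ‖a‖ ≠ 0 := norm_ne_zero_iff.2 h0
    have := h (‖a‖⁻¹ • a) ((IsSelfAdjoint.all _).smul ha) (by simp [norm_smul, hn])
    rw [map_smul, map_smul, smul_eq_mul, smul_eq_mul] at this
    exact mul_left_cancel₀ (inv_ne_zero hn) this
  ext a
  have := hsa (a + star a) (IsSelfAdjoint.add_star_self a)
  rw [map_add, map_add, hf.map_star, hf'.map_star] at this
  linarith

theorem exists_isSelfAdjoint_lt_apply {B : Type*} [CStarAlgebra B] (ψ : B →L[ℝ] ℝ)
    (hψ : ∀ a, ψ (star a) = ψ a) {r : ℝ} (hr : r < ‖ψ‖) :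
    ∃ x : B, IsSelfAdjoint x ∧ ‖x‖ ≤ 1 ∧ r < ψ x := by
  obtain ⟨y, hy, hry⟩ := ψ.exists_lt_apply_of_lt_opNorm hr
  wlog hpos : 0 ≤ ψ y generalizing y
  · exact this (-y) (by simpa using hy) (by simpa using hry) (by rw [map_neg]; linarith)
  refine ⟨(2⁻¹ : ℝ) • (y + star y), (IsSelfAdjoint.all _).smul (IsSelfAdjoint.add_star_self y),
    ?_, ?_⟩
  · rw [norm_smul, Real.norm_of_nonneg (by norm_num)]
    have := norm_add_le y (star y)
    rw [norm_star] at this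
    linarith
  · rw [map_smul, map_add, hψ, smul_eq_mul]
    rw [Real.norm_of_nonneg hpos] at hry
    linarith

section Unital

variable {B : Type*} [CStarAlgebra B] [PartialOrder B] [StarOrderedRing B]

theorem IsSelfAdjoint.norm_le_of_mem_Icc_algebraMap [Nontrivial B] {a : B} {t : ℝ}
    (ha : IsSelfAdjoint a) (h₁ : -algebraMap ℝ B t ≤ a) (h₂ : a ≤ algebraMap ℝ B t) :
    ‖a‖ ≤ t := by
  rw [← map_neg, algebraMap_le_iff_le_spectrum] at h₁
  rw [le_algebraMap_iff_spectrum_le] at h₂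
  rcases CStarAlgebra.norm_or_neg_norm_mem_spectrum ha with h | h
  · exact h₂ _ h
  · linarith [h₁ _ h]

theorem star_add_self_add_algebraMap_nonneg (p : B) {r : ℝ} (hr : ‖p‖ ≤ r) :
    0 ≤ p + star p + algebraMap ℝ B (2 * r) := by
  have h := (IsSelfAdjoint.add_star_self p).neg_algebraMap_norm_le_self
  have hn : ‖p + star p‖ ≤ 2 * r := by
    calc ‖p + star p‖ ≤ ‖p‖ + ‖star p‖ := norm_add_le _ _
      _ ≤ 2 * r := by rw [norm_star]; linarith
  have h' : algebraMap ℝ B ‖p + star p‖ ≤ algebraMap ℝ B (2 * r) := algebraMap_mono B hn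
  calc (0 : B) = algebraMap ℝ B (2 * r) - algebraMap ℝ B (2 * r) := by simp
    _ ≤ algebraMap ℝ B (2 * r) - algebraMap ℝ B ‖p + star p‖ := by gcongr
    _ ≤ p + star p + algebraMap ℝ B (2 * r) := by
      rw [sub_eq_neg_add]; gcongr

/-- The cone of elements with positive real part. -/
def accretiveCone (B : Type*) [CStarAlgebra B] [PartialOrder B] [StarOrderedRing B] :
    PointedCone ℝ B where
  carrier := {p | 0 ≤ p + star p}
  zero_mem' := by simp
  add_mem' {p q} hp hq := by
    have : p + q + star (p + q) = (p + star p) + (q + star q) := by rw [star_add]; abel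
    rw [Set.mem_ofPred_eq, this]
    exact add_nonneg hp hq
  smul_mem' c p hp := by
    have : c • p + star (c • p) = (c : ℝ) • (p + star p) := by
      change (c : ℝ) • p + star ((c : ℝ) • p) = _
      rw [star_smul, star_trivial, smul_add]
    rw [Set.mem_ofPred_eq, this]
    exact smul_nonneg c.2 hp

theorem mem_accretiveCone {p : B} : p ∈ accretiveCone B ↔ 0 ≤ p + star p := Iff.rfl

theorem isHermitianPositive_of_accretiveCone {f : B →ₗ[ℝ] ℝ}
    (hf : ∀ a ∈ accretiveCone B, 0 ≤ f a) : IsHermitianPositive f where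
  nonneg a ha := hf a (add_nonneg ha (star_nonneg_iff.2 ha))
  map_star a := by
    have h₁ := hf (star a - a) (by simp [mem_accretiveCone])
    have h₂ := hf (a - star a) (by simp [mem_accretiveCone])
    rw [map_sub] at h₁ h₂
    linarith

/-- Jordan decomposition of a bounded hermitian functional. -/
theorem exists_jordan_decomposition [Nontrivial B] (ψ : B →L[ℝ] ℝ)
    (hψ : ∀ a, ψ (star a) = ψ a) :
    ∃ f g : B →ₗ[ℝ] ℝ, IsHermitianPositive f ∧ IsHermitianPositive g ∧
      (∀ a, f a - g a = ψ a) ∧ f 1 + g 1 = ‖ψ‖ := by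
  obtain ⟨τ, hτ⟩ := SeparatingDual.exists_eq_one (R := ℝ) (one_ne_zero (α := B))
  let S : PointedCone ℝ (B × B) := (accretiveCone B).prod (accretiveCone B)
  let D : Submodule ℝ (B × B) :=
    (Submodule.span ℝ {(1 : B)}).comap (LinearMap.coprod LinearMap.id LinearMap.id)
  have hD : ∀ {p q : B}, (p, q) ∈ D ↔ ∃ t : ℝ, t • 1 = p + q := by
    intro p q
    simp [D, Submodule.mem_span_singleton]
  let G : B × B →ₗ[ℝ] ℝ := (2⁻¹ : ℝ) •
    (LinearMap.coprod (ψ : B →ₗ[ℝ] ℝ) (-(ψ : B →ₗ[ℝ] ℝ)) +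
      ‖ψ‖ • LinearMap.coprod (τ : B →ₗ[ℝ] ℝ) (τ : B →ₗ[ℝ] ℝ))
  have hG : ∀ p q : B, G (p, q) = 2⁻¹ * (ψ p - ψ q + ‖ψ‖ * (τ p + τ q)) := by
    intro p q
    simp [G]
    ring
  obtain ⟨F, hF, hFS⟩ := riesz_extension S (G.toPMap D) (by
    rintro ⟨⟨p, q⟩, hpq⟩ ⟨hp, hq⟩
    change 0 ≤ G (p, q)
    rw [hG]
    obtain ⟨t, ht⟩ := hD.1 hpq
    change 0 ≤ p + star p at hp
    change 0 ≤ q + star q at hq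
    have hsum : (p + star p) + (q + star q) = algebraMap ℝ B (2 * t) := by
      have h := congrArg star ht
      simp only [star_smul, star_one, star_add, star_trivial] at h
      rw [Algebra.algebraMap_eq_smul_one, mul_smul, two_smul]
      nth_rewrite 1 [ht]
      rw [h]
      abel
    have hτt : τ p + τ q = t := by rw [← map_add, ← ht, map_smul, hτ]; simp
    have hn : ‖(p - q) + star (p - q)‖ ≤ 2 * t := by
      apply (IsSelfAdjoint.add_star_self _).norm_le_of_mem_Icc_algebraMap
      · rw [← hsum, ← sub_nonneg]
        have : p - q + star (p - q) - -(p + star p + (q + star q)) =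
            (p + star p) + (p + star p) := by rw [star_sub]; abel
        rw [this]
        exact add_nonneg hp hp
      · rw [← hsum, ← sub_nonneg]
        have : p + star p + (q + star q) - (p - q + star (p - q)) =
            (q + star q) + (q + star q) := by rw [star_sub]; abel
        rw [this]
        exact add_nonneg hq hq
    have hle := (abs_le.1 ((ψ.le_opNorm _).trans
      (mul_le_mul_of_nonneg_left hn (norm_nonneg ψ)))).1
    rw [map_add, hψ, map_sub] at hle
    rw [hτt]
    linarith) (by
    rintro ⟨p, q⟩
    refine ⟨⟨((‖p‖ + ‖q‖) • 1, (‖p‖ + ‖q‖) • 1), hD.2 ⟨2 * (‖p‖ + ‖q‖), ?_⟩⟩, ?_, ?_⟩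
    · rw [mul_smul, two_smul]
    · have h := star_add_self_add_algebraMap_nonneg p
        (le_add_of_nonneg_right (norm_nonneg q) : ‖p‖ ≤ ‖p‖ + ‖q‖)
      rw [Algebra.algebraMap_eq_smul_one, mul_smul, two_smul] at h
      simp only [SetLike.mem_coe, mem_accretiveCone]
      convert h using 1
      simp only [Prod.mk_add_mk, star_add, star_smul, star_one, star_trivial]
      abel
    · have h := star_add_self_add_algebraMap_nonneg q
        (le_add_of_nonneg_left (norm_nonneg p) : ‖q‖ ≤ ‖p‖ + ‖q‖)
      rw [Algebra.algebraMap_eq_smul_one, mul_smul, two_smul] at h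
      simp only [SetLike.mem_coe, mem_accretiveCone]
      convert h using 1
      simp only [Prod.mk_add_mk, star_add, star_smul, star_one, star_trivial]
      abel)
  refine ⟨F.comp (LinearMap.inl ℝ B B), F.comp (LinearMap.inr ℝ B B),
    isHermitianPositive_of_accretiveCone fun a ha => hFS _ ⟨ha, zero_mem _⟩,
    isHermitianPositive_of_accretiveCone fun a ha => hFS _ ⟨zero_mem _, ha⟩, fun a => ?_, ?_⟩
  · have h : F (a, -a) = G (a, -a) := hF ⟨(a, -a), hD.2 ⟨0, by simp⟩⟩
    rw [hG] at h
    simp only [LinearMap.comp_apply, LinearMap.inl_apply, LinearMap.inr_apply, ← map_sub,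
      Prod.mk_sub_mk, sub_zero, zero_sub]
    rw [h, map_neg, map_neg]
    ring
  · have h : F (1, 1) = G (1, 1) := hF ⟨(1, 1), hD.2 ⟨2, by rw [two_smul]⟩⟩
    rw [hG, hτ] at h
    simp only [LinearMap.comp_apply, LinearMap.inl_apply, LinearMap.inr_apply, ← map_add,
      Prod.mk_add_mk, add_zero, zero_add]
    rw [h]
    ring

namespace IsHermitianPositive

variable {f : B →ₗ[ℝ] ℝ}

theorem mono (hf : IsHermitianPositive f) {a b : B} (h : a ≤ b) : f a ≤ f b := by
  have := hf.nonneg _ (sub_nonneg.2 h)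
  rwa [map_sub, sub_nonneg] at this

theorem abs_map_conjugate_le (hf : IsHermitianPositive f) {a c : B} (ha : IsSelfAdjoint a)
    (ha₁ : ‖a‖ ≤ 1) (hc : IsSelfAdjoint c) (hcc : c * c ≤ c) : |f (c * a * c)| ≤ f c := by
  have h₁ : (1 : B) = algebraMap ℝ B 1 := by simp
  have hau : a ≤ 1 := ha.le_algebraMap_norm_self.trans (h₁ ▸ algebraMap_mono B ha₁)
  have hal : -1 ≤ a :=
    (neg_le_neg (h₁ ▸ algebraMap_mono B ha₁)).trans ha.neg_algebraMap_norm_le_self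
  have hu := star_left_conjugate_le_conjugate hau c
  have hl := star_left_conjugate_le_conjugate hal c
  rw [hc.star_eq] at hu hl
  simp only [mul_neg, mul_one, neg_mul] at hu hl
  have := hf.mono (hu.trans hcc)
  have h' := hf.mono (neg_le.1 hl |>.trans hcc)
  rw [map_neg] at h'
  exact abs_le.2 ⟨by linarith, this⟩

theorem mul_abs_map_cross_le (hf : IsHermitianPositive f) {a b c : B} (ha : IsSelfAdjoint a)
    (ha₁ : ‖a‖ ≤ 1) (hb : IsSelfAdjoint b) (hb₁ : b * b ≤ 1) (hc : IsSelfAdjoint c)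
    (hcc : c * c ≤ c) (ε : ℝ) :
    ε * |f (b * a * c + c * a * b)| ≤ ε ^ 2 * f 1 + f c := by
  have haa : a * a ≤ 1 := by
    have h := CStarAlgebra.star_mul_le_algebraMap_norm_sq (a := a)
    rw [ha.star_eq] at h
    refine h.trans ?_
    simpa using algebraMap_mono B (pow_le_one₀ (norm_nonneg a) ha₁ : ‖a‖ ^ 2 ≤ 1)
  have hbab : b * (a * a) * b ≤ 1 := by
    have h := star_left_conjugate_le_conjugate haa b
    rw [hb.star_eq, mul_one] at h
    exact h.trans hb₁
  have key : ∀ δ : ℝ, 0 ≤ δ ^ 2 * f 1 + δ * f (b * a * c + c * a * b) + f c := by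
    intro δ
    have h := hf.nonneg _ (star_mul_self_nonneg (δ • (a * b) + c))
    have e : star (δ • (a * b) + c) * (δ • (a * b) + c) =
        δ ^ 2 • (b * (a * a) * b) + δ • (b * a * c + c * a * b) + c * c := by
      simp only [star_add, star_smul, star_mul, star_trivial, ha.star_eq, hb.star_eq, hc.star_eq,
        add_mul, mul_add, smul_mul_assoc, mul_smul_comm, smul_add, smul_smul, pow_two, mul_assoc]
      abel
    rw [e, map_add, map_add, map_smul, map_smul, smul_eq_mul, smul_eq_mul] at h
    have h₁ := mul_le_mul_of_nonneg_left (hf.mono hbab) (sq_nonneg δ)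
    have h₂ := hf.mono hcc
    linarith
  have k₁ := key ε
  have k₂ := key (-ε)
  rcases abs_cases (f (b * a * c + c * a * b)) with ⟨h, -⟩ | ⟨h, -⟩ <;> rw [h] <;> nlinarith

end IsHermitianPositive

/-- Uniqueness of the Jordan decomposition. -/
theorem jordan_decomposition_unique (ψ : B →L[ℝ] ℝ) (hψ : ∀ a, ψ (star a) = ψ a)
    {f g f' g' : B →ₗ[ℝ] ℝ}
    (hf : IsHermitianPositive f) (hg : IsHermitianPositive g)
    (hf' : IsHermitianPositive f') (hg' : IsHermitianPositive g')
    (hfg : ∀ a, f a - g a = ψ a) (hfg' : ∀ a, f' a - g' a = ψ a)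
    (hn : f 1 + g 1 = ‖ψ‖) (hn' : f' 1 + g' 1 = ‖ψ‖) : f = f' := by
  refine hf.eq_of_selfAdjoint hf' fun a ha ha₁ => ?_
  have bound : ∀ ε : ℝ, 0 < ε → |f a - f' a| ≤ 4 * ε ^ 2 + ε * (2 * ‖ψ‖ + 2) := by
    intro ε hε
    obtain ⟨x, hx, hx₁, hψx⟩ := exists_isSelfAdjoint_lt_apply ψ hψ
      (sub_lt_self ‖ψ‖ (pow_pos hε 2))
    have hxx : x * x ≤ 1 := by
      have h := CStarAlgebra.star_mul_le_algebraMap_norm_sq (a := x)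
      rw [hx.star_eq] at h
      refine h.trans ?_
      simpa using algebraMap_mono B (pow_le_one₀ (norm_nonneg x) hx₁ : ‖x‖ ^ 2 ≤ 1)
    obtain ⟨b, hb⟩ : ∃ b : B, b = (2⁻¹ : ℝ) • (1 + x) := ⟨_, rfl⟩
    obtain ⟨c, hc⟩ : ∃ c : B, c = (2⁻¹ : ℝ) • (1 - x) := ⟨_, rfl⟩
    have hbs : IsSelfAdjoint b := hb ▸ (IsSelfAdjoint.all _).smul ((IsSelfAdjoint.one B).add hx)
    have hcs : IsSelfAdjoint c := hc ▸ (IsSelfAdjoint.all _).smul ((IsSelfAdjoint.one B).sub hx)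
    have hbc : b + c = 1 := by rw [hb, hc]; module
    have hbx : b - b * b = (4⁻¹ : ℝ) • (1 - x * x) := by
      rw [hb]
      simp only [smul_mul_smul_comm, add_mul, mul_add, one_mul, mul_one]
      module
    have hcx : c - c * c = (4⁻¹ : ℝ) • (1 - x * x) := by
      rw [hc]
      simp only [smul_mul_smul_comm, sub_mul, mul_sub, one_mul, mul_one]
      module
    have hx' : 0 ≤ (4⁻¹ : ℝ) • (1 - x * x) := smul_nonneg (by norm_num) (sub_nonneg.2 hxx)
    have hbb : b * b ≤ b := sub_nonneg.1 (hbx ▸ hx')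
    have hcc : c * c ≤ c := sub_nonneg.1 (hcx ▸ hx')
    have hb0 : 0 ≤ b := (by simpa [hbs.star_eq] using star_mul_self_nonneg b : 0 ≤ b * b).trans hbb
    have hc0 : 0 ≤ c := (by simpa [hcs.star_eq] using star_mul_self_nonneg c : 0 ≤ c * c).trans hcc
    have hb1 : b * b ≤ 1 := hbb.trans (hbc ▸ le_add_of_nonneg_right hc0)
    have small : ∀ {F G : B →ₗ[ℝ] ℝ}, IsHermitianPositive F → IsHermitianPositive G →
        (∀ a, F a - G a = ψ a) → F 1 + G 1 = ‖ψ‖ →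
        F c ≤ ε ^ 2 ∧ G b ≤ ε ^ 2 ∧ F 1 ≤ ‖ψ‖ := by
      intro F G hF hG h h1
      have e₁ : F c + G b = 2⁻¹ * (‖ψ‖ - ψ x) := by
        rw [hb, hc, ← h1, ← h x]
        simp only [map_smul, map_add, map_sub, smul_eq_mul]
        ring
      have := hF.nonneg c hc0
      have := hG.nonneg b hb0
      have := hG.nonneg 1 zero_le_one
      have := pow_pos hε 2
      exact ⟨by linarith, by linarith, by linarith⟩
    have cross : ∀ {F : B →ₗ[ℝ] ℝ}, IsHermitianPositive F → F c ≤ ε ^ 2 → F 1 ≤ ‖ψ‖ →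
        |F (b * a * c + c * a * b)| ≤ ε * (‖ψ‖ + 1) := by
      intro F hF h₁ h₂
      have h := hF.mul_abs_map_cross_le ha ha₁ hbs hb1 hcs hcc ε
      have h3 := mul_le_mul_of_nonneg_left h₂ (sq_nonneg ε)
      refine le_of_mul_le_mul_left (h.trans ?_) hε
      linarith
    obtain ⟨hfc, hgb, hf1⟩ := small hf hg hfg hn
    obtain ⟨hfc', hgb', hf1'⟩ := small hf' hg' hfg' hn'
    have d : a = b * a * b + (b * a * c + c * a * b) + c * a * c := by
      calc a = (b + c) * a * (b + c) := by rw [hbc]; simp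
        _ = _ := by noncomm_ring
    have e₁ := abs_le.1 (cross hf hfc hf1)
    have e₂ := abs_le.1 (cross hf' hfc' hf1')
    have e₃ := abs_le.1 (hf.abs_map_conjugate_le ha ha₁ hcs hcc)
    have e₄ := abs_le.1 (hf'.abs_map_conjugate_le ha ha₁ hcs hcc)
    have e₅ := abs_le.1 (hg.abs_map_conjugate_le ha ha₁ hbs hbb)
    have e₆ := abs_le.1 (hg'.abs_map_conjugate_le ha ha₁ hbs hbb)
    have e₇ := hfg (b * a * b)
    have e₈ := hfg' (b * a * b)
    have e₉ := congrArg f d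
    have e₁₀ := congrArg f' d
    rw [map_add, map_add] at e₉ e₁₀
    rw [abs_le]
    constructor <;> linarith [e₁.1, e₁.2, e₂.1, e₂.2, e₃.1, e₃.2, e₄.1, e₄.2, e₅.1, e₅.2,
      e₆.1, e₆.2]
  have hlim : Filter.Tendsto (fun ε : ℝ => 4 * ε ^ 2 + ε * (2 * ‖ψ‖ + 2))
      (nhdsWithin 0 (Set.Ioi 0)) (nhds 0) := by
    have : Continuous (fun ε : ℝ => 4 * ε ^ 2 + ε * (2 * ‖ψ‖ + 2)) := by fun_prop
    simpa using (this.tendsto 0).mono_left nhdsWithin_le_nhds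
  have := ge_of_tendsto hlim (eventually_nhdsWithin_of_forall bound)
  exact sub_eq_zero.1 (abs_eq_zero.1 (le_antisymm this (abs_nonneg _)))

/-- Complexification of a hermitian positive real functional to a positive functional. -/
theorem IsHermitianPositive.exists_continuousLinearMap {f : B →ₗ[ℝ] ℝ}
    (hf : IsHermitianPositive f) :
    ∃ F : B →L[ℂ] ℂ, (∀ a, 0 ≤ a → 0 ≤ F a) ∧ (∀ a, (F a).re = f a) ∧
      ∀ a, F a = f a - Complex.I * f (Complex.I • a) := by
  have hpos : ∀ a, 0 ≤ a → 0 ≤ (Module.Dual.extendRCLike f : B →ₗ[ℂ] ℂ) a := by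
    intro a ha
    have h := hf.map_star (Complex.I • a)
    rw [star_smul, (IsSelfAdjoint.of_nonneg ha).star_eq] at h
    have h0 : f (Complex.I • a) = 0 := by
      simp only [Complex.star_def, Complex.conj_I, neg_smul, map_neg] at h
      linarith
    have e : (Module.Dual.extendRCLike f : B →ₗ[ℂ] ℂ) a = f a - Complex.I * f (Complex.I • a) :=
      Module.Dual.extendRCLike_apply (𝕜 := ℂ) f a
    rw [e, h0]
    simpa using hf.nonneg a ha
  obtain ⟨C, hC⟩ := (PositiveLinearMap.mk₀
    (Module.Dual.extendRCLike f : B →ₗ[ℂ] ℂ) hpos).exists_norm_apply_le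
  exact ⟨(Module.Dual.extendRCLike f : B →ₗ[ℂ] ℂ).mkContinuous C hC, hpos,
    Module.Dual.re_extendRCLike_apply (𝕜 := ℂ) f, Module.Dual.extendRCLike_apply (𝕜 := ℂ) f⟩

theorem IsHermitianPositive.conjugate {f : B →ₗ[ℝ] ℝ} (hf : IsHermitianPositive f) (u : B) :
    IsHermitianPositive (f.comp (LinearMap.mulLeftRight ℝ (u, star u))) where
  nonneg a ha := by
    simpa using hf.nonneg _ (star_right_conjugate_nonneg ha u)
  map_star a := by
    have := hf.map_star (u * a * star u)
    simpa [mul_assoc] using this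

/-- A bounded hermitian functional invariant under unitary conjugation is a difference of positive
tracial functionals. -/
theorem exists_positive_tracial_sub [Nontrivial B] (ψ : B →L[ℝ] ℝ)
    (hψ : ∀ a, ψ (star a) = ψ a) (hu : ∀ u ∈ unitary B, ∀ a, ψ (u * a * star u) = ψ a) :
    ∃ F G : B →L[ℂ] ℂ, (∀ a, 0 ≤ a → 0 ≤ F a) ∧ (∀ a, 0 ≤ a → 0 ≤ G a) ∧
      (∀ a b, F (a * b) = F (b * a)) ∧ (∀ a b, G (a * b) = G (b * a)) ∧
      ∀ a, (F a - G a).re = ψ a := by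
  obtain ⟨f, g, hf, hg, hfg, hn⟩ := exists_jordan_decomposition ψ hψ
  have hfu : ∀ u ∈ unitary B, ∀ a, f (u * a * star u) = f a := by
    intro u huu a
    have h := jordan_decomposition_unique ψ hψ (hf.conjugate u) (hg.conjugate u) hf hg
      (fun a => by simpa [hu u huu a] using hfg (u * a * star u)) hfg
      (by simpa [Unitary.mul_star_self_of_mem huu] using hn) hn
    simpa using LinearMap.congr_fun h a
  have hgu : ∀ u ∈ unitary B, ∀ a, g (u * a * star u) = g a := by
    intro u huu a
    have := hfg (u * a * star u)
    rw [hu u huu, hfu u huu] at this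
    linarith [hfg a]
  obtain ⟨F, hF, hFre, hFf⟩ := hf.exists_continuousLinearMap
  obtain ⟨G, hG, hGre, hGg⟩ := hg.exists_continuousLinearMap
  refine ⟨F, G, hF, hG, mul_comm_of_unitary_conjugate F fun u huu a => ?_,
    mul_comm_of_unitary_conjugate G fun u huu a => ?_, fun a => ?_⟩
  · rw [hFf, hFf, hfu u huu, ← smul_mul_assoc, ← mul_smul_comm, hfu u huu]
  · rw [hGg, hGg, hgu u huu, ← smul_mul_assoc, ← mul_smul_comm, hgu u huu]
  · rw [Complex.sub_re, hFre, hGre, hfg]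

end Unital

theorem exists_isSelfAdjoint_apply_ne_zero {A : Type*} [NonUnitalCStarAlgebra A]
    {φ : A →L[ℂ] ℂ} (hφ : φ ≠ 0) : ∃ a, IsSelfAdjoint a ∧ φ a ≠ 0 := by
  by_contra! h
  refine hφ (ContinuousLinearMap.ext fun x => ?_)
  rw [← realPart_add_I_smul_imaginaryPart x, map_add, map_smul, h _ (realPart x).2,
    h _ (imaginaryPart x).2]
  simp

theorem exists_positive_tracial_of_tracial {A : Type*} [NonUnitalCStarAlgebra A] [PartialOrder A]
    [StarOrderedRing A] {φ : A →L[ℂ] ℂ} (hφ : φ ≠ 0) (hc : ∀ a b, φ (a * b) = φ (b * a)) :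
    ∃ τ : A →L[ℂ] ℂ, τ ≠ 0 ∧ (∀ a, 0 ≤ a → 0 ≤ τ a) ∧ ∀ a b, τ (a * b) = τ (b * a) := by
  obtain ⟨a, ha, hφa⟩ := exists_isSelfAdjoint_apply_ne_zero hφ
  let snd : Unitization ℂ A →L[ℂ] A := ⟨Unitization.sndHom ℂ ℂ A, Unitization.continuous_snd⟩
  let inr : A →L[ℂ] Unitization ℂ A := ⟨Unitization.inrHom ℂ ℂ A, Unitization.continuous_inr⟩
  let Φ : Unitization ℂ A →L[ℂ] ℂ := (starRingEnd ℂ (φ a) • φ).comp snd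
  have hΦ : ∀ x, Φ x = starRingEnd ℂ (φ a) * φ x.snd := fun x => rfl
  have hΦc : ∀ x y, Φ (x * y) = Φ (y * x) := by
    intro x y
    simp only [hΦ, Unitization.snd_mul, map_add, hc x.snd y.snd]
    ring
  let ψ₀ : Unitization ℂ A →L[ℝ] ℝ := Complex.reCLM.comp (Φ.restrictScalars ℝ)
  let ψ : Unitization ℂ A →L[ℝ] ℝ :=
    ψ₀ + ψ₀.comp (starL' ℝ : Unitization ℂ A ≃L[ℝ] Unitization ℂ A).toContinuousLinearMap
  have hψ : ∀ x, ψ x = (Φ x).re + (Φ (star x)).re := fun x => rfl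
  have hΦu : ∀ u ∈ unitary (Unitization ℂ A), ∀ x, Φ (u * x * star u) = Φ x := by
    intro u hu x
    rw [hΦc, ← mul_assoc, Unitary.star_mul_self_of_mem hu, one_mul]
  obtain ⟨F, G, hF, hG, hFc, hGc, hFG⟩ := exists_positive_tracial_sub ψ
    (fun x => by rw [hψ, hψ, star_star, add_comm])
    (fun u hu x => by
      have e : star (u * x * star u) = u * star x * star u := by simp [mul_assoc]
      rw [hψ, hψ, e, hΦu u hu, hΦu u hu])
  have restrict : ∀ H : Unitization ℂ A →L[ℂ] ℂ, H.comp inr ≠ 0 → (∀ x, 0 ≤ x → 0 ≤ H x) →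
      (∀ x y, H (x * y) = H (y * x)) →
      ∃ τ : A →L[ℂ] ℂ, τ ≠ 0 ∧ (∀ a, 0 ≤ a → 0 ≤ τ a) ∧ ∀ a b, τ (a * b) = τ (b * a) := by
    intro H h0 hpos hcomm
    refine ⟨H.comp inr, h0, fun x hx => hpos _ (Unitization.inr_nonneg_iff.2 hx), fun x y => ?_⟩
    change H ((x * y : A) : Unitization ℂ A) = H ((y * x : A) : Unitization ℂ A)
    rw [Unitization.inr_mul, Unitization.inr_mul, hcomm]
  by_cases hF0 : F.comp inr = 0
  · refine restrict G (fun hG0 => hφa ?_) hG hGc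
    have h := hFG (inr a)
    have hFa : F (inr a) = 0 := congrArg (fun T : A →L[ℂ] ℂ => T a) hF0
    have hGa : G (inr a) = 0 := congrArg (fun T : A →L[ℂ] ℂ => T a) hG0
    have hs : star (inr a) = inr a := by
      change star (a : Unitization ℂ A) = (a : Unitization ℂ A)
      rw [← Unitization.inr_star, ha.star_eq]
    have hv : Φ (inr a) = (Complex.normSq (φ a) : ℂ) := (Complex.normSq_eq_conj_mul_self).symm
    rw [hFa, hGa, hψ, hs, hv, Complex.ofReal_re, sub_zero, Complex.zero_re] at h
    exact Complex.normSq_eq_zero.1 (by linarith)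
  · exact restrict F hF0 hF hFc

theorem exists_tracial_state_of_tracial {A : Type*} [NonUnitalCStarAlgebra A] [PartialOrder A]
    [StarOrderedRing A] {φ : A →L[ℂ] ℂ} (hφ : φ ≠ 0) (hc : ∀ a b, φ (a * b) = φ (b * a)) :
    ∃ τ : A →L[ℂ] ℂ, ‖τ‖ = 1 ∧ (∀ a, 0 ≤ a → 0 ≤ τ a) ∧ ∀ a b, τ (a * b) = τ (b * a) := by
  obtain ⟨τ, h0, hpos, hcomm⟩ := exists_positive_tracial_of_tracial hφ hc
  refine ⟨((‖τ‖⁻¹ : ℝ) : ℂ) • τ, ?_, fun a ha => ?_, fun a b => ?_⟩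
  · rw [norm_smul, Complex.norm_real, norm_inv, norm_norm, inv_mul_cancel₀ (norm_ne_zero_iff.2 h0)]
  · exact mul_nonneg (Complex.zero_le_real.2 (inv_nonneg.2 (norm_nonneg τ))) (hpos a ha)
  · simp only [_root_.smul_apply, hcomm a b]

/-- A subspace of a normed space is not dense iff it is annihilated by a non-zero functional. -/
theorem Submodule.closure_ne_univ_iff_exists_continuousLinearMap {E : Type*}
    [NormedAddCommGroup E] [NormedSpace ℂ E] (p : Submodule ℂ E) :
    closure (p : Set E) ≠ Set.univ ↔ ∃ φ : E →L[ℂ] ℂ, φ ≠ 0 ∧ ∀ x ∈ p, φ x = 0 := by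
  constructor
  · intro h
    obtain ⟨x, hx⟩ := (Set.ne_univ_iff_exists_notMem _).1 h
    have : IsClosed (p.topologicalClosure : Set E) := p.isClosed_topologicalClosure
    have hx' : p.topologicalClosure.mkQ x ≠ 0 := by
      rwa [Submodule.mkQ_apply, Ne, Submodule.Quotient.mk_eq_zero]
    obtain ⟨g, hg⟩ := SeparatingDual.exists_ne_zero (R := ℂ) hx'
    refine ⟨g.comp p.topologicalClosure.mkQL, fun h0 => hg ?_, fun y hy => ?_⟩
    · exact congrArg (fun T : E →L[ℂ] ℂ => T x) h0
    · have : p.topologicalClosure.mkQ y = 0 := by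
        rw [Submodule.mkQ_apply, Submodule.Quotient.mk_eq_zero]
        exact p.le_topologicalClosure hy
      change g (p.topologicalClosure.mkQ y) = 0
      rw [this, map_zero]
  · rintro ⟨φ, h0, hφ⟩ h
    refine h0 (ContinuousLinearMap.ext fun x => ?_)
    have hle : closure (p : Set E) ⊆ {x | φ x = 0} :=
      closure_minimal hφ (isClosed_eq φ.continuous continuous_const)
    exact hle (h ▸ Set.mem_univ x)

/-- A C*-algebra `A` admits a tracial functional iff it admits a tracial
state; equivalently, the closed span of commutators of `A` is proper iff `A` has a
tracial state. -/
theorem exists_tracial_functional_iff_exists_tracial_state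
    (A : Type*) [NonUnitalNormedRing A] [StarRing A] [CStarRing A]
    [NormedSpace ℂ A] [IsScalarTower ℂ A A] [SMulCommClass ℂ A A] [StarModule ℂ A]
    [CompleteSpace A] [PartialOrder A] [StarOrderedRing A] :
    ((∃ φ : A →L[ℂ] ℂ, φ ≠ 0 ∧ ∀ a b : A, φ (a * b) = φ (b * a)) ↔
      (∃ φ : A →L[ℂ] ℂ, ‖φ‖ = 1 ∧ (∀ a : A, 0 ≤ a → 0 ≤ φ a) ∧
        ∀ a b : A, φ (a * b) = φ (b * a))) ∧
    ((closure (Submodule.span ℂ {z : A | ∃ x y : A, z = x * y - y * x} : Set A)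
        ≠ Set.univ) ↔
      (∃ φ : A →L[ℂ] ℂ, ‖φ‖ = 1 ∧ (∀ a : A, 0 ≤ a → 0 ≤ φ a) ∧
        ∀ a b : A, φ (a * b) = φ (b * a))) := by
  let : NonUnitalCStarAlgebra A := { }
  have key : (∃ φ : A →L[ℂ] ℂ, φ ≠ 0 ∧ ∀ a b : A, φ (a * b) = φ (b * a)) ↔
      (∃ φ : A →L[ℂ] ℂ, ‖φ‖ = 1 ∧ (∀ a : A, 0 ≤ a → 0 ≤ φ a) ∧
        ∀ a b : A, φ (a * b) = φ (b * a)) := by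
    constructor
    · rintro ⟨φ, h0, hc⟩
      exact exists_tracial_state_of_tracial h0 hc
    · rintro ⟨φ, h1, -, hc⟩
      exact ⟨φ, norm_ne_zero_iff.1 (h1 ▸ one_ne_zero), hc⟩
  refine ⟨key, ?_⟩
  rw [Submodule.closure_ne_univ_iff_exists_continuousLinearMap, ← key]
  refine exists_congr fun φ => and_congr_right fun _ => ?_
  constructor
  · intro h a b
    have := h _ (Submodule.subset_span ⟨a, b, rfl⟩)
    rwa [map_sub, sub_eq_zero] at this
  · intro h x hx
    have hle : Submodule.span ℂ {z : A | ∃ x y : A, z = x * y - y * x} ≤ φ.ker := by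
      rw [Submodule.span_le]
      rintro _ ⟨a, b, rfl⟩
      simp [h a b]
    exact hle hx
end

section
/- Let H be an infinite dimensional separable Hilbert space. Then the only non-trivial proper closed Lie ideals of B(H) are ℂ1, K(H), and ℂ1 + K(H). -/
open Filter Topology InnerProductSpace

section HilbertSpace

variable {H : Type*} [NormedAddCommGroup H] [InnerProductSpace ℂ H]

theorem Orthonormal.countable_of_separableSpace [TopologicalSpace.SeparableSpace H] {ι : Type*}
    {e : ι → H} (he : Orthonormal ℂ e) : Countable ι := by
  refine Pairwise.countable_of_isOpen_disjoint (s := fun i => Metric.ball (e i) (1 / 2)) ?_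
    (fun i => Metric.isOpen_ball) (fun i => ⟨e i, Metric.mem_ball_self (by norm_num)⟩)
  intro i j hij
  refine Metric.ball_disjoint_ball ?_
  have h := norm_sub_sq (𝕜 := ℂ) (e i) (e j)
  rw [he.2 hij, he.1 i, he.1 j] at h
  rw [dist_eq_norm]
  norm_num at h
  nlinarith [norm_nonneg (e i - e j)]

theorem HilbertBasis.clm_ext {ι : Type*} (b : HilbertBasis ι ℂ H) {S T : H →L[ℂ] H}
    (h : ∀ i, S (b i) = T (b i)) : S = T :=
  ContinuousLinearMap.ext_on (Submodule.dense_iff_topologicalClosure_eq_top.mpr b.dense_span)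
    (by rintro _ ⟨i, rfl⟩; exact h i)

theorem HilbertBasis.ext_inner_left {ι : Type*} (b : HilbertBasis ι ℂ H) {x y : H}
    (h : ∀ i, inner ℂ (b i) x = inner ℂ (b i) y) : x = y := by
  apply b.repr.injective
  ext i
  rw [b.repr_apply_apply, b.repr_apply_apply, h]

theorem isCompactOperator_rankOne (x y : H) : IsCompactOperator (rankOne ℂ x y : H →L[ℂ] H) :=
  (isCompactOperator_of_locallyCompactSpace_rng
    (ContinuousLinearMap.toSpanSingleton ℂ x)).comp_clm (innerSL ℂ y)

theorem isCompactOperator_starProjection (F : Submodule ℂ H) [FiniteDimensional ℂ F] :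
    IsCompactOperator F.starProjection :=
  (isCompactOperator_of_locallyCompactSpace_rng F.subtypeL).comp_clm F.orthogonalProjectionOnto

theorem ContinuousLinearMap.exists_eq_smul_one_of_forall_commute [Nontrivial H] {T : H →L[ℂ] H}
    (hT : ∀ S : H →L[ℂ] H, T * S = S * T) : ∃ c : ℂ, T = c • (1 : H →L[ℂ] H) := by
  obtain ⟨y, hy⟩ := exists_ne (0 : H)
  refine ⟨(inner ℂ y y)⁻¹ * inner ℂ y (T y), ContinuousLinearMap.ext fun x => ?_⟩
  have h := congrArg (fun S : H →L[ℂ] H => S y) (hT (rankOne ℂ x y))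
  simp only [mul_apply_eq_comp, rankOne_apply, map_smul] at h
  rw [smul_apply, one_apply_eq_self, mul_smul, ← h, inv_smul_smul₀ (inner_self_ne_zero.mpr hy)]

variable [CompleteSpace H]

theorem exists_hilbertBasis_nat [TopologicalSpace.SeparableSpace H]
    (hinf : ¬ FiniteDimensional ℂ H) : Nonempty (HilbertBasis ℕ ℂ H) := by
  obtain ⟨w, b, hb⟩ := exists_hilbertBasis ℂ H
  have hc : Countable w := b.orthonormal.countable_of_separableSpace
  have hi : Infinite w := by
    by_contra h
    have hw : Finite w := not_infinite_iff_finite.mp h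
    have := Fintype.ofFinite w
    exact hinf (Module.Basis.finiteDimensional_of_finite b.toOrthonormalBasis.toBasis)
  obtain ⟨f⟩ := nonempty_equiv_of_countable (α := ℕ) (β := w)
  refine ⟨HilbertBasis.mk (b.orthonormal.comp f f.injective) ?_⟩
  rw [f.surjective.range_comp, b.dense_span]

theorem HilbertBasis.exists_isometry_apply_eq (b : HilbertBasis ℕ ℂ H) {e : ℕ → H}
    (he : Orthonormal ℂ e) :
    ∃ V : H →L[ℂ] H, star V * V = 1 ∧ ∀ n, V (b n) = e n := by
  let W : H →ₗᵢ[ℂ] H := he.orthogonalFamily.linearIsometry.comp b.repr.toLinearIsometry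
  have hW : ∀ n, W (b n) = e n := fun n => by
    simp [W, b.repr_self]
  refine ⟨W.toContinuousLinearMap, ?_, hW⟩
  ext x
  refine _root_.ext_inner_left ℂ fun y => ?_
  simp [ContinuousLinearMap.star_eq_adjoint, ContinuousLinearMap.adjoint_inner_right]

theorem exists_norm_eq_one_le_norm_of_not_isCompactOperator {T : H →L[ℂ] H}
    (hT : ¬ IsCompactOperator T) :
    ∃ ε : ℝ, 0 < ε ∧ ∀ F : Submodule ℂ H, FiniteDimensional ℂ F →
      ∃ x ∈ Fᗮ, ‖x‖ = 1 ∧ ε ≤ ‖T x‖ := by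
  by_contra! h
  refine hT (isClosed_setOfPred_isCompactOperator.closure_subset
    (Metric.mem_closure_iff.mpr fun ε hε => ?_))
  obtain ⟨F, hF, hFx⟩ := h (ε / 2) (half_pos hε)
  refine ⟨T * F.starProjection, (isCompactOperator_starProjection F).clm_comp T, ?_⟩
  rw [dist_eq_norm]
  refine lt_of_le_of_lt (ContinuousLinearMap.opNorm_le_bound _ (half_pos hε).le fun x => ?_)
    (half_lt_self hε)
  have hx : (T - T * F.starProjection) x = T (Fᗮ.starProjection x) := by
    simp [Submodule.starProjection_orthogonal]
  rw [hx]
  refine le_trans ?_ (mul_le_mul_of_nonneg_left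
    (Fᗮ.norm_starProjection_apply_le x) (half_pos hε).le)
  generalize hy : Fᗮ.starProjection x = y
  have hyF : y ∈ Fᗮ := hy ▸ Submodule.starProjection_apply_mem _ _
  rcases eq_or_ne y 0 with rfl | hy0
  · simp
  have hn : ‖y‖ ≠ 0 := norm_ne_zero_iff.mpr hy0
  have := hFx (((‖y‖⁻¹ : ℝ) : ℂ) • y) (Submodule.smul_mem _ _ hyF)
    (by rw [norm_smul]; simp [hn])
  rw [map_smul, norm_smul, Complex.norm_real, norm_inv, norm_norm,
    inv_mul_lt_iff₀ (norm_pos_iff.mpr hy0)] at this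
  linarith

theorem exists_orthonormal_inner_eq_zero {T : H →L[ℂ] H} (hT : ¬ IsCompactOperator T)
    (S : H →L[ℂ] H) :
    ∃ ε : ℝ, 0 < ε ∧ ∃ e : ℕ → H, Orthonormal ℂ e ∧ (∀ n, ε ≤ ‖T (e n)‖) ∧
      ∀ m n, m ≠ n → inner ℂ (e m) (S (e n)) = 0 := by
  classical
  obtain ⟨ε, hε, h⟩ := exists_norm_eq_one_le_norm_of_not_isCompactOperator hT
  refine ⟨ε, hε, ?_⟩
  obtain ⟨e, he, hr⟩ := exists_seq_of_forall_finset_exists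
    (fun x : H => ‖x‖ = 1 ∧ ε ≤ ‖T x‖)
    (fun x y => inner ℂ x y = 0 ∧ inner ℂ (S x) y = 0 ∧ inner ℂ (star S x) y = 0) (by
      intro s _
      obtain ⟨x, hx, hx1, hx2⟩ := h (Submodule.span ℂ (s ∪ s.image S ∪ s.image ⇑(star S) : Finset H))
        (FiniteDimensional.span_finset ℂ _)
      refine ⟨x, ⟨hx1, hx2⟩, fun y hy => ⟨?_, ?_, ?_⟩⟩ <;>
      · refine hx _ (Submodule.subset_span ?_)
        simp only [Finset.coe_union, Finset.coe_image, Set.mem_union, Set.mem_image,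
          Finset.mem_coe]
        grind)
  refine ⟨e, ⟨fun n => (he n).1, fun m n hmn => ?_⟩, fun n => (he n).2, fun m n hmn => ?_⟩
  · rcases hmn.lt_or_gt with h | h
    · exact (hr m n h).1
    · exact inner_eq_zero_symm.mp (hr n m h).1
  · rcases hmn.lt_or_gt with h | h
    · have := (hr m n h).2.2
      rwa [ContinuousLinearMap.star_eq_adjoint, ContinuousLinearMap.adjoint_inner_left] at this
    · exact inner_eq_zero_symm.mp (hr n m h).2.1

theorem exists_mul_mul_eq_one_of_not_isCompactOperator (b : HilbertBasis ℕ ℂ H) {T : H →L[ℂ] H}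
    (hT : ¬ IsCompactOperator T) : ∃ A B : H →L[ℂ] H, A * T * B = 1 := by
  obtain ⟨ε, hε, e, he, hTe, horth⟩ := exists_orthonormal_inner_eq_zero hT (star T * T)
  obtain ⟨V, hV, hVb⟩ := b.exists_isometry_apply_eq he
  have horth' : ∀ m n, m ≠ n → inner ℂ (T (V (b m))) (T (V (b n))) = 0 := fun m n hmn => by
    have := horth m n hmn
    rwa [ContinuousLinearMap.star_eq_adjoint, mul_apply_eq_comp,
      ContinuousLinearMap.adjoint_inner_right, ← hVb, ← hVb] at this
  have key : ∀ (c : ℕ → ℂ) (s : Finset ℕ),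
      ε ^ 2 * ‖∑ i ∈ s, c i • b i‖ ^ 2 ≤ ‖∑ i ∈ s, c i • T (V (b i))‖ ^ 2 := by
    intro c s
    induction s using Finset.induction_on with
    | empty => simp
    | insert a s ha ih =>
      rw [Finset.sum_insert ha, Finset.sum_insert ha, @norm_add_sq ℂ, @norm_add_sq ℂ]
      have h1 : inner ℂ (c a • b a) (∑ i ∈ s, c i • b i) = 0 := by
        rw [inner_sum]
        refine Finset.sum_eq_zero fun i hi => ?_
        rw [inner_smul_left, inner_smul_right, b.orthonormal.2 (by grind)]
        simp
      have h2 : inner ℂ (c a • T (V (b a))) (∑ i ∈ s, c i • T (V (b i))) = 0 := by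
        rw [inner_sum]
        refine Finset.sum_eq_zero fun i hi => ?_
        rw [inner_smul_left, inner_smul_right, horth' _ _ (by grind)]
        simp
      rw [h1, h2, norm_smul, norm_smul, b.orthonormal.1, hVb]
      have := mul_le_mul_of_nonneg_left (pow_le_pow_left₀ hε.le (hTe a) 2) (sq_nonneg ‖c a‖)
      simp only [map_zero]
      nlinarith
  have hbound : ∀ x, ε ^ 2 * ‖x‖ ^ 2 ≤ ‖T (V x)‖ ^ 2 := by
    intro x
    have h1 := b.hasSum_repr x
    have h2 : HasSum (fun i => b.repr x i • T (V (b i))) (T (V x)) := by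
      simpa using (T * V).hasSum h1
    refine le_of_tendsto_of_tendsto ((h1.norm.pow 2).const_mul _) (h2.norm.pow 2)
      (Eventually.of_forall fun s => key _ s)
  have hu : IsUnit (star V * star T * T * V) := by
    refine ContinuousLinearMap.isUnit_of_forall_le_norm_inner_map _
      (c := ⟨ε ^ 2, sq_nonneg ε⟩) (by exact_mod_cast pow_pos hε 2) fun x => ?_
    have : inner ℂ ((star V * star T * T * V) x) x = ((‖T (V x)‖ : ℂ)) ^ 2 := by
      simp only [mul_apply_eq_comp, ContinuousLinearMap.star_eq_adjoint,
        ContinuousLinearMap.adjoint_inner_left]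
      rw [inner_self_eq_norm_sq_to_K]; rfl
    rw [this, norm_pow, Complex.norm_real, norm_norm, mul_comm]
    exact hbound x
  obtain ⟨C, hC⟩ := hu.exists_left_inv
  exact ⟨C * star V * star T, V, by simpa only [mul_assoc] using hC⟩

theorem exists_isometry_isCompactOperator_sub (b : HilbertBasis ℕ ℂ H)
    (hinf : ¬ FiniteDimensional ℂ H) (T : H →L[ℂ] H) :
    ∃ (V : H →L[ℂ] H) (c : ℂ), star V * V = 1 ∧
      IsCompactOperator (star V * T * V - c • (1 : H →L[ℂ] H)) := by
  have h1 : ¬ IsCompactOperator (1 : H →L[ℂ] H) := fun h =>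
    hinf (FiniteDimensional.of_isCompactOperator_id (𝕜 := ℂ) h)
  obtain ⟨-, -, e, he, -, horth⟩ := exists_orthonormal_inner_eq_zero h1 T
  obtain ⟨c, -, φ, hφ, hc⟩ := tendsto_subseq_of_bounded
    (Metric.isBounded_closedBall (x := (0 : ℂ)) (r := ‖T‖))
    (x := fun n => inner ℂ (e n) (T (e n))) (fun n => by
      rw [mem_closedBall_zero_iff]
      refine (norm_inner_le_norm _ _).trans ?_
      rw [he.1, one_mul]
      simpa [he.1] using T.le_opNorm (e n))
  obtain ⟨ψ, hψ, hcψ⟩ := extraction_forall_of_eventually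
    (P := fun n k => ‖inner ℂ (e (φ k)) (T (e (φ k))) - c‖ < (1 / 2 : ℝ) ^ n) (fun n => by
      simpa [dist_eq_norm] using hc.eventually (Metric.ball_mem_nhds c (by positivity)))
  have hinj : Function.Injective (φ ∘ ψ) := (hφ.comp hψ).injective
  obtain ⟨V, hV, hVb⟩ := b.exists_isometry_apply_eq (he.comp _ hinj)
  refine ⟨V, c, hV, ?_⟩
  set μ : ℕ → ℂ := fun n => inner ℂ (e (φ (ψ n))) (T (e (φ (ψ n)))) - c with hμ
  have hs : Summable fun n => μ n • (rankOne ℂ (b n) (b n) : H →L[ℂ] H) := by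
    refine Summable.of_norm_bounded summable_geometric_two fun n => ?_
    rw [norm_smul, norm_rankOne, b.orthonormal.1, mul_one, mul_one]
    exact (hcψ n).le
  have hD : star V * T * V - c • (1 : H →L[ℂ] H) =
      ∑' n, μ n • (rankOne ℂ (b n) (b n) : H →L[ℂ] H) := by
    refine b.clm_ext fun n => b.ext_inner_left fun m => ?_
    have h2 : (∑' n, μ n • (rankOne ℂ (b n) (b n) : H →L[ℂ] H)) (b n) = μ n • b n := by
      refine ((ContinuousLinearMap.apply ℂ H (b n)).hasSum hs.hasSum).unique ?_
      have h3 := hasSum_single (f := fun k => μ k • inner ℂ (b k) (b n) • b k) n fun k hk => by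
        rw [b.orthonormal.2 hk, zero_smul, smul_zero]
      simpa [b.orthonormal.1] using h3
    rw [h2]
    simp only [sub_apply, mul_apply_eq_comp,
      smul_apply, one_apply_eq_self, inner_sub_right,
      ContinuousLinearMap.star_eq_adjoint, ContinuousLinearMap.adjoint_inner_right, hVb,
      inner_smul_right, Function.comp_apply]
    rcases eq_or_ne m n with rfl | hmn
    · simp [hμ, b.orthonormal.1]
    · rw [horth (φ (ψ m)) (φ (ψ n)) (hinj.ne hmn), b.orthonormal.2 hmn]
      simp
  rw [hD]
  refine isCompactOperator_of_tendsto hs.hasSum (Eventually.of_forall fun s => ?_)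
  refine Submodule.sum_mem (compactOperator (RingHom.id ℂ) H H) fun n _ => ?_
  exact (isCompactOperator_rankOne (b n) (b n)).smul (μ n)

end HilbertSpace

section CuntzPair

/-- Two isometries whose range projections add up to `1`. -/
structure IsCuntzPair {A : Type*} [Ring A] [StarRing A] (v w : A) : Prop where
  star_mul_left : star v * v = 1
  star_mul_right : star w * w = 1
  star_left_mul_right : star v * w = 0
  star_right_mul_left : star w * v = 0
  add_eq_one : v * star v + w * star w = 1

namespace IsCuntzPair

variable {A : Type*} [Ring A] [StarRing A] {v w : A}

theorem symm (h : IsCuntzPair v w) : IsCuntzPair w v :=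
  ⟨h.2, h.1, h.4, h.3, by rw [add_comm, h.5]⟩

theorem star_mul_left_assoc (h : IsCuntzPair v w) (x : A) : star v * (v * x) = x := by
  rw [← mul_assoc, h.1, one_mul]

theorem star_left_mul_right_assoc (h : IsCuntzPair v w) (x : A) : star v * (w * x) = 0 := by
  rw [← mul_assoc, h.3, zero_mul]

theorem eq_sum_corners (h : IsCuntzPair v w) (T : A) :
    T = v * (star v * T * v) * star v + v * (star v * T * w) * star w +
      (w * (star w * T * v) * star v + w * (star w * T * w) * star w) := by
  calc T = (v * star v + w * star w) * T * (v * star v + w * star w) := by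
        rw [h.add_eq_one, one_mul, mul_one]
    _ = _ := by noncomm_ring

end IsCuntzPair

/-- The elements `a` whose image `v a w*` in the off-diagonal corner lies in `L`. -/
def Submodule.corner {A : Type*} [Ring A] [StarRing A] [Algebra ℂ A] (L : Submodule ℂ A)
    (v w : A) : Submodule ℂ A :=
  L.comap (LinearMap.mulLeft ℂ v ∘ₗ LinearMap.mulRight ℂ (star w))

section Algebra

variable {A : Type*} [Ring A] [StarRing A] [Algebra ℂ A] {L : Submodule ℂ A} {v w : A}

theorem Submodule.mem_corner {a : A} : a ∈ L.corner v w ↔ v * (a * star w) ∈ L := Iff.rfl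

variable (h : IsCuntzPair v w) (hLie : ∀ T ∈ L, ∀ S : A, T * S - S * T ∈ L)
include h hLie

theorem IsCuntzPair.mul_mem_corner {a : A} (ha : a ∈ L.corner v w) (x : A) :
    a * x ∈ L.corner v w := by
  have := hLie _ ha (w * (x * star w))
  simpa [Submodule.mem_corner, mul_assoc, h.symm.star_mul_left_assoc,
    h.symm.star_left_mul_right_assoc] using this

theorem IsCuntzPair.mem_corner_mul {a : A} (ha : a ∈ L.corner v w) (x : A) :
    x * a ∈ L.corner v w := by
  have := L.neg_mem (hLie _ ha (v * (x * star v)))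
  simpa [Submodule.mem_corner, mul_assoc, h.star_mul_left_assoc,
    h.symm.star_left_mul_right_assoc] using this

theorem IsCuntzPair.compress_mem_corner {T : A} (hT : T ∈ L) :
    star v * T * w ∈ L.corner v w := by
  have h1 := hLie _ hT (v * star v)
  have h2 := hLie _ h1 (v * star v)
  have h3 := L.smul_mem (2⁻¹ : ℂ) (L.sub_mem h2 h1)
  have he : (v * star v) * (v * star v) = v * star v := by
    rw [mul_assoc, h.star_mul_left_assoc]
  rw [Submodule.mem_corner]
  convert! h3 using 1
  have hw : v * (star v * T * w * star w) = (v * star v) * T * (1 - v * star v) := by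
    rw [← h.add_eq_one]; noncomm_ring
  rw [hw]
  generalize v * star v = e at he
  have : (T * e - e * T) * e - e * (T * e - e * T) - (T * e - e * T) =
      (2 : ℂ) • (e * T * (1 - e)) := by
    rw [two_smul]
    have h4 : T * e * e = T * e := by rw [mul_assoc, he]
    have h5 : e * (e * T) = e * T := by rw [← mul_assoc, he]
    rw [sub_mul, mul_sub, h4, h5]
    noncomm_ring
  rw [this, smul_smul, inv_mul_cancel₀ two_ne_zero, one_smul]

theorem IsCuntzPair.corner_swap_le : L.corner w v ≤ L.corner v w := by
  intro a ha
  have h1 := hLie _ (L.neg_mem (hLie _ (Submodule.mem_corner.mp ha) (v * star w))) (v * star w)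
  have h3 := L.smul_mem (2⁻¹ : ℂ) h1
  rw [Submodule.mem_corner]
  convert! h3 using 1
  simp only [mul_assoc, sub_mul, mul_sub, neg_mul, mul_neg, h.star_mul_left_assoc,
    h.symm.star_mul_left_assoc, h.symm.star_left_mul_right_assoc, mul_zero]
  module

theorem IsCuntzPair.commutator_mem {a : A} (ha : a ∈ L.corner v w) (b : A) :
    w * (a * b - b * a) * star w ∈ L := by
  have h1 := hLie _ (Submodule.mem_corner.mp ha) (w * (b * star v))
  have h2 := hLie _ (Submodule.mem_corner.mp <| h.mul_mem_corner hLie ha b) (w * star v)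
  convert! L.sub_mem h1 h2 using 1
  simp only [mul_assoc, sub_mul, mul_sub, h.star_mul_left_assoc, h.symm.star_mul_left_assoc]
  abel

theorem IsCuntzPair.commutator_compress_mem_corner {T : A} (hT : T ∈ L) (b : A) :
    star v * T * v * b - b * (star w * T * w) ∈ L.corner v w := by
  have := h.compress_mem_corner hLie (hLie _ hT (v * (b * star w)))
  simpa [mul_assoc, sub_mul, mul_sub, h.star_mul_left_assoc, h.symm.star_mul_left_assoc,
    h.symm.star_mul_left] using this

theorem IsCuntzPair.commutator_compress_mem_corner' {T : A} (hT : T ∈ L) (b : A) :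
    star v * T * v * b - b * (star v * T * v) ∈ L.corner v w := by
  have h1 := h.commutator_compress_mem_corner hLie hT b
  have h2 := h.mem_corner_mul hLie (h.commutator_compress_mem_corner hLie hT 1) b
  convert! (L.corner v w).sub_mem h1 h2 using 1
  noncomm_ring

theorem IsCuntzPair.sub_smul_one_mem_corner {T : A} (hT : T ∈ L) {c : ℂ}
    (hc : star v * T * v - c • (1 : A) ∈ L.corner v w) : T - c • (1 : A) ∈ L.corner v w := by
  have hJ : ∀ a ∈ L.corner v w, ∀ x y, x * a * y ∈ L.corner v w := fun a ha x y =>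
    h.mul_mem_corner hLie (h.mem_corner_mul hLie ha x) y
  have h12 := h.compress_mem_corner hLie hT
  have h21 := h.corner_swap_le hLie (h.symm.compress_mem_corner hLie hT)
  have h22 : star w * T * w - c • (1 : A) ∈ L.corner v w := by
    have := (L.corner v w).sub_mem hc (h.commutator_compress_mem_corner hLie hT 1)
    convert! this using 1
    noncomm_ring
  convert! add_mem (add_mem (hJ _ hc v (star v)) (hJ _ h12 v (star w)))
    (add_mem (hJ _ h21 w (star v)) (hJ _ h22 w (star w))) using 1
  conv_lhs => rw [h.eq_sum_corners T, ← h.add_eq_one]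
  simp only [mul_sub, sub_mul, smul_add, mul_smul_comm, smul_mul_assoc, mul_one]
  abel

end Algebra

section CStarAlgebra

variable {A : Type*} [CStarAlgebra A] {v w : A}

/-- The amplification `c ↦ v c v* + w c w*`. -/
def IsCuntzPair.amplification (h : IsCuntzPair v w) : A →⋆ₙₐ[ℂ] A where
  toFun c := v * c * star v + w * c * star w
  map_smul' r c := by simp
  map_zero' := by simp
  map_add' a b := by noncomm_ring
  map_mul' a b := by
    simp only [mul_add, add_mul, mul_assoc, h.star_mul_left_assoc, h.star_left_mul_right_assoc,
      h.symm.star_mul_left_assoc, h.symm.star_left_mul_right_assoc, mul_zero, add_zero, zero_add]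
  map_star' a := by simp [mul_assoc]

/-- A closed subspace containing all commutators of a two-sided ideal with the algebra
contains the ideal. -/
theorem IsCuntzPair.le_of_commutator_mem (h : IsCuntzPair v w) {J M : Submodule ℂ A}
    (hl : ∀ a ∈ J, ∀ x, x * a ∈ J) (hr : ∀ a ∈ J, ∀ x, a * x ∈ J)
    (hM : IsClosed (M : Set A)) (hJM : ∀ a ∈ J, ∀ b, a * b - b * a ∈ M) : J ≤ M := by
  intro c hc
  set D := h.amplification
  have hDJ : ∀ a ∈ J, D a ∈ J := fun a ha =>
    J.add_mem (hr _ (hl _ ha _) _) (hr _ (hl _ ha _) _)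
  have hstep : ∀ a ∈ J, a - (2⁻¹ : ℂ) • D a ∈ M := by
    intro a ha
    have h1 := hJM _ (hl _ ha v) (star v)
    have h2 := hJM _ (hl _ ha w) (star w)
    rw [h.star_mul_left_assoc] at h1
    rw [h.symm.star_mul_left_assoc] at h2
    convert! M.smul_mem (-2⁻¹ : ℂ) (M.add_mem h1 h2) using 1
    change a - (2⁻¹ : ℂ) • (v * a * star v + w * a * star w) = _
    module
  have hiter : ∀ n : ℕ, D^[n] c ∈ J ∧ c - (2⁻¹ : ℂ) ^ n • D^[n] c ∈ M := by
    intro n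
    induction n with
    | zero => simpa using hc
    | succ n ih =>
      rw [Function.iterate_succ_apply']
      refine ⟨hDJ _ ih.1, ?_⟩
      convert! M.add_mem ih.2 (M.smul_mem ((2⁻¹ : ℂ) ^ n) (hstep _ ih.1)) using 1
      module
  have hnorm : ∀ n : ℕ, ‖D^[n] c‖ ≤ ‖c‖ := by
    intro n
    induction n with
    | zero => simp
    | succ n ih =>
      rw [Function.iterate_succ_apply']
      exact (NonUnitalStarAlgHom.norm_apply_le D _).trans ih
  have hlim : Tendsto (fun n : ℕ => c - (2⁻¹ : ℂ) ^ n • D^[n] c) atTop (𝓝 c) := by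
    have h0 : Tendsto (fun n : ℕ => (2⁻¹ : ℂ) ^ n • D^[n] c) atTop (𝓝 0) := by
      refine squeeze_zero_norm (a := fun n => (2⁻¹ : ℝ) ^ n * ‖c‖) (fun n => ?_) ?_
      · rw [norm_smul, norm_pow, norm_inv, Complex.norm_ofNat]
        exact mul_le_mul_of_nonneg_left (hnorm n) (by positivity)
      · simpa using (tendsto_pow_atTop_nhds_zero_of_lt_one (r := (2⁻¹ : ℝ)) (by norm_num)
          (by norm_num)).mul_const ‖c‖
    simpa using h0.const_sub c
  exact hM.mem_of_tendsto hlim (Eventually.of_forall fun n => (hiter n).2)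

theorem IsCuntzPair.corner_le (h : IsCuntzPair v w) {L : Submodule ℂ A}
    (hLc : IsClosed (L : Set A)) (hLie : ∀ T ∈ L, ∀ S : A, T * S - S * T ∈ L) :
    L.corner v w ≤ L := by
  have hdiag : ∀ {v w : A}, IsCuntzPair v w → ∀ a ∈ L.corner v w, w * a * star w ∈ L := by
    intro v w h
    exact h.le_of_commutator_mem (J := L.corner v w)
      (M := L.comap (LinearMap.mulRight ℂ (star w) ∘ₗ LinearMap.mulLeft ℂ w))
      (fun a ha => h.mem_corner_mul hLie ha) (fun a ha => h.mul_mem_corner hLie ha)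
      (hLc.preimage (f := fun x => w * x * star w) (by fun_prop))
      (fun a ha => h.commutator_mem hLie ha)
  intro a ha
  have hJ : ∀ x y, x * a * y ∈ L.corner v w := fun x y =>
    h.mul_mem_corner hLie (h.mem_corner_mul hLie ha x) y
  have hswap := h.symm.corner_swap_le hLie
  rw [h.eq_sum_corners a]
  refine add_mem (add_mem ?_ ?_) (add_mem ?_ ?_)
  · exact hdiag h.symm _ (hswap (hJ _ _))
  · rw [mul_assoc]; exact hJ _ _
  · rw [mul_assoc]; exact hswap (hJ _ _)
  · exact hdiag h _ (hJ _ _)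

end CStarAlgebra

end CuntzPair

section BoundedOperators

variable {H : Type*} [NormedAddCommGroup H] [InnerProductSpace ℂ H]

/-- A nonzero closed two-sided ideal of `B(H)` contains every compact operator. -/
theorem IsCompactOperator.mem_of_ne_bot {J : Submodule ℂ (H →L[ℂ] H)} (hJ : J ≠ ⊥)
    (hl : ∀ a ∈ J, ∀ x, x * a ∈ J) (hr : ∀ a ∈ J, ∀ x, a * x ∈ J)
    (hJc : IsClosed (J : Set (H →L[ℂ] H))) {K : H →L[ℂ] H} (hK : IsCompactOperator K) :
    K ∈ J := by
  obtain ⟨T, hTJ, hT0⟩ := J.exists_mem_ne_zero_of_ne_bot hJ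
  obtain ⟨z, hz⟩ : ∃ z, T z ≠ 0 := by
    by_contra! h
    exact hT0 (ContinuousLinearMap.ext h)
  have hrank : ∀ x y : H, (rankOne ℂ x y : H →L[ℂ] H) ∈ J := by
    intro x y
    have h1 := J.smul_mem (inner ℂ (T z) (T z))⁻¹
      (hr _ (hl _ hTJ (rankOne ℂ x (T z))) (rankOne ℂ z y))
    convert! h1 using 1
    ext u
    simp only [smul_apply, mul_apply_eq_comp, rankOne_apply, map_smul, smul_smul]
    rw [mul_comm (inner ℂ y u), inv_mul_cancel_left₀ (inner_self_ne_zero.mpr hz)]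
  have hproj : ∀ F : Submodule ℂ H, ∀ _ : FiniteDimensional ℂ F, F.starProjection ∈ J := by
    intro F _
    rw [(stdOrthonormalBasis ℂ F).starProjection_eq_sum_rankOne]
    exact J.sum_mem fun i _ => hrank _ _
  refine hJc.closure_subset (Metric.mem_closure_iff.mpr fun ε hε => ?_)
  obtain ⟨t, -, htf, ht⟩ := exists_finite_cover_balls_of_isCompact_closure
    (IsCompactOperator.isCompact_closure_image_closedBall (f := (K : H →ₗ[ℂ] H)) hK 1)
    (half_pos hε)
  have hF : FiniteDimensional ℂ (Submodule.span ℂ t) := FiniteDimensional.span_of_finite ℂ htf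
  set F := Submodule.span ℂ t with hFt
  refine ⟨F.starProjection * K, hr _ (hproj F hF) K, ?_⟩
  rw [dist_eq_norm]
  refine lt_of_le_of_lt (ContinuousLinearMap.opNorm_le_of_unit_norm (half_pos hε).le fun x hx => ?_)
    (half_lt_self hε)
  obtain ⟨y, hyt, hy⟩ : ∃ y ∈ t, K x ∈ Metric.ball y (ε / 2) := by
    simpa using ht ⟨x, by simp [hx], rfl⟩
  have hyF : F.starProjection y = y :=
    Submodule.starProjection_eq_self_iff.mpr (Submodule.subset_span hyt)
  have h2 : (K - F.starProjection * K) x = Fᗮ.starProjection (K x - y) := by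
    simp [Submodule.starProjection_orthogonal, hyF]
  rw [h2]
  refine (Fᗮ.norm_starProjection_apply_le _).trans ?_
  rw [← dist_eq_norm]
  exact hy.le

variable [CompleteSpace H]

theorem HilbertBasis.exists_isCuntzPair (b : HilbertBasis ℕ ℂ H) :
    ∃ v w : H →L[ℂ] H, IsCuntzPair v w := by
  obtain ⟨v, hv, hvb⟩ := b.exists_isometry_apply_eq
    (b.orthonormal.comp (fun n => 2 * n) (fun m n h => by simpa using h))
  obtain ⟨w, hw, hwb⟩ := b.exists_isometry_apply_eq
    (b.orthonormal.comp (fun n => 2 * n + 1) (fun m n h => by simpa using h))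
  have hvw : star v * w = 0 := by
    refine b.clm_ext fun n => b.ext_inner_left fun m => ?_
    rw [mul_apply_eq_comp, ContinuousLinearMap.star_eq_adjoint,
      ContinuousLinearMap.adjoint_inner_right, hvb, hwb, Function.comp_apply, Function.comp_apply,
      b.orthonormal.2 (by lia)]
    simp
  have hwv : star w * v = 0 := by
    simpa using congrArg star hvw
  refine ⟨v, w, hv, hw, hvw, hwv, b.clm_ext fun n => ?_⟩
  have h1 : (v * star v + w * star w) * v = v := by
    rw [add_mul, mul_assoc, mul_assoc, hv, hwv, mul_one, mul_zero, add_zero]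
  have h2 : (v * star v + w * star w) * w = w := by
    rw [add_mul, mul_assoc, mul_assoc, hw, hvw, mul_one, mul_zero, zero_add]
  rcases Nat.even_or_odd' n with ⟨k, rfl | rfl⟩
  · have := congrArg (fun T : H →L[ℂ] H => T (b k)) h1
    simpa only [mul_apply_eq_comp, hvb, Function.comp_apply, one_apply_eq_self] using this
  · have := congrArg (fun T : H →L[ℂ] H => T (b k)) h2
    simpa only [mul_apply_eq_comp, hwb, Function.comp_apply, one_apply_eq_self] using this

/-- An operator commuting with every operator modulo the compacts is a compact perturbation of
a scalar. -/
theorem exists_isCompactOperator_sub_smul_one (b : HilbertBasis ℕ ℂ H)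
    (hinf : ¬ FiniteDimensional ℂ H) {T : H →L[ℂ] H}
    (hT : ∀ S : H →L[ℂ] H, IsCompactOperator (T * S - S * T)) :
    ∃ c : ℂ, IsCompactOperator (T - c • (1 : H →L[ℂ] H)) := by
  obtain ⟨V, c, hV, hc⟩ := exists_isometry_isCompactOperator_sub b hinf T
  refine ⟨c, ?_⟩
  have h : T - c • (1 : H →L[ℂ] H) =
      (star V * T * V - c • (1 : H →L[ℂ] H)) - star V * (T * V - V * T) := by
    rw [mul_sub, ← mul_assoc, ← mul_assoc, hV, one_mul]
    abel
  rw [h]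
  exact hc.sub ((hT V).clm_comp (star V))

end BoundedOperators

/-- For an infinite dimensional separable Hilbert space `H`, the only
non-trivial proper closed Lie ideals of `B(H)` are `ℂ1`, `K(H)` and `ℂ1 + K(H)`. -/
theorem closed_lieIdeals_of_BH
    (H : Type*) [NormedAddCommGroup H] [InnerProductSpace ℂ H] [CompleteSpace H]
    [TopologicalSpace.SeparableSpace H] (hinf : ¬ FiniteDimensional ℂ H)
    (L : Submodule ℂ (H →L[ℂ] H)) (hLc : IsClosed (L : Set (H →L[ℂ] H)))
    (hLie : ∀ T ∈ L, ∀ S : H →L[ℂ] H, T * S - S * T ∈ L) :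
    L = ⊥ ∨ L = ⊤ ∨
      (L : Set (H →L[ℂ] H)) = {T : H →L[ℂ] H | ∃ c : ℂ, T = c • (1 : H →L[ℂ] H)} ∨
      (L : Set (H →L[ℂ] H)) = {T : H →L[ℂ] H | IsCompactOperator ⇑T} ∨
      (L : Set (H →L[ℂ] H)) = {T : H →L[ℂ] H | ∃ (c : ℂ) (K : H →L[ℂ] H),
        IsCompactOperator ⇑K ∧ T = c • (1 : H →L[ℂ] H) + K} := by
  obtain ⟨b⟩ := exists_hilbertBasis_nat hinf
  obtain ⟨v, w, h⟩ := b.exists_isCuntzPair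
  have : Nontrivial H := by
    by_contra hH
    have := not_nontrivial_iff_subsingleton.mp hH
    exact hinf inferInstance
  have hJl : ∀ a ∈ L.corner v w, ∀ x, x * a ∈ L.corner v w := fun a ha =>
    h.mem_corner_mul hLie ha
  have hJr : ∀ a ∈ L.corner v w, ∀ x, a * x ∈ L.corner v w := fun a ha =>
    h.mul_mem_corner hLie ha
  have hJc : IsClosed (L.corner v w : Set (H →L[ℂ] H)) :=
    hLc.preimage (f := fun x => v * (x * star w)) (by fun_prop)
  have hJL : L.corner v w ≤ L := h.corner_le hLc hLie
  have hcomm : ∀ T ∈ L, ∀ S : H →L[ℂ] H,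
      star v * T * v * S - S * (star v * T * v) ∈ L.corner v w := fun T hT =>
    h.commutator_compress_mem_corner' hLie hT
  by_cases hbot : L.corner v w = ⊥
  · have hscalar : ∀ T ∈ L, ∃ c : ℂ, T = c • (1 : H →L[ℂ] H) := by
      intro T hT
      obtain ⟨c, hc⟩ := ContinuousLinearMap.exists_eq_smul_one_of_forall_commute fun S => by
        simpa [hbot, sub_eq_zero] using hcomm T hT S
      have := h.sub_smul_one_mem_corner hLie hT (c := c) (by rw [hc, sub_self]; exact zero_mem _)
      exact ⟨c, by simpa [hbot, sub_eq_zero] using this⟩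
    by_cases h1 : (1 : H →L[ℂ] H) ∈ L
    · refine Or.inr (Or.inr (Or.inl (Set.Subset.antisymm hscalar ?_)))
      rintro _ ⟨c, rfl⟩
      exact L.smul_mem c h1
    · refine Or.inl ((Submodule.eq_bot_iff L).mpr fun T hT => ?_)
      obtain ⟨c, rfl⟩ := hscalar T hT
      rcases eq_or_ne c 0 with rfl | hc
      · exact zero_smul _ _
      · exact absurd ((L.smul_mem_iff hc).mp hT) h1
  by_cases hcpt : ∀ T ∈ L.corner v w, IsCompactOperator T
  · have hKL : ∀ K : H →L[ℂ] H, IsCompactOperator K → K ∈ L := fun K hK =>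
      hJL (hK.mem_of_ne_bot hbot hJl hJr hJc)
    have hdecomp : ∀ T ∈ L, ∃ c : ℂ, IsCompactOperator (T - c • (1 : H →L[ℂ] H)) := by
      intro T hT
      obtain ⟨c, hc⟩ := exists_isCompactOperator_sub_smul_one b hinf
        fun S => hcpt _ (hcomm T hT S)
      exact ⟨c, hcpt _ (h.sub_smul_one_mem_corner hLie hT (hc.mem_of_ne_bot hbot hJl hJr hJc))⟩
    refine Or.inr (Or.inr (Or.inr ?_))
    by_cases h1 : (1 : H →L[ℂ] H) ∈ L
    · refine Or.inr (Set.Subset.antisymm (fun T hT => ?_) ?_)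
      · obtain ⟨c, hc⟩ := hdecomp T hT
        exact ⟨c, _, hc, (add_sub_cancel _ _).symm⟩
      · rintro _ ⟨c, K, hK, rfl⟩
        exact L.add_mem (L.smul_mem c h1) (hKL K hK)
    · refine Or.inl (Set.Subset.antisymm (fun T hT => ?_) hKL)
      obtain ⟨c, hc⟩ := hdecomp T hT
      rcases eq_or_ne c 0 with rfl | hc0
      · simpa using hc
      · have := L.sub_mem hT (hKL _ hc)
        rw [sub_sub_cancel] at this
        exact absurd ((L.smul_mem_iff hc0).mp this) h1
  · push Not at hcpt
    obtain ⟨T, hT, hTc⟩ := hcpt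
    obtain ⟨A, B, hAB⟩ := exists_mul_mul_eq_one_of_not_isCompactOperator b hTc
    have h1 : (1 : H →L[ℂ] H) ∈ L.corner v w := hAB ▸ hJr _ (hJl _ hT A) B
    exact Or.inr (Or.inl (eq_top_iff.mpr fun S _ => hJL (by simpa using hJl _ h1 S)))
end
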